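/- Fix a positive integer c₂ and take x = n − c₂ (so that the number of failures n − x = c₂ is constant). Then lim_{n→∞} [ h(f_{n,n−c₂}) + log n ] = c₂ + log(c₂!) − c₂·(H_{c₂} − γ) + 1, where H_{c₂} = 1 + 1/2 + ⋯ + 1/c₂ is the partial sum of the harmonic series and γ is the Euler–Mascheroni constant. -/

import Mathlib

open MeasureTheory Real Filter

/-- The Beta(x+1, n-x+1) posterior density `f_{n,x}` on `[0,1]`, extended by `0` outside. -/
noncomputable def betaDensity (n x : ℕ) (p : ℝ) : ℝ :=
  if 0 ≤ p ∧ p ≤ 1 then ((n : ℝ) + 1) * (n.choose x : ℝ) * p ^ x * (1 - p) ^ (n - x) else 0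

/-- Differential entropy `h(f) = -∫ f log f`. -/
noncomputable def diffEntropy (f : ℝ → ℝ) : ℝ :=
  -∫ z : ℝ, f z * Real.log (f z)

/-- Partial sum of the harmonic series `H_k = 1 + 1/2 + ⋯ + 1/k`. -/
noncomputable def harmonicSum (k : ℕ) : ℝ :=
  ∑ i ∈ Finset.range k, (1 : ℝ) / (i + 1)

open Topology

/-- `∫₀¹ p ^ a * (1 - p) ^ b dp`, in closed form. -/
noncomputable def natBeta (a b : ℕ) : ℝ :=
  (a.factorial : ℝ) * b.factorial / (a + b + 1).factorial

lemma natBeta_comm (a b : ℕ) : natBeta a b = natBeta b a := by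
  rw [natBeta, natBeta, Nat.add_comm a b, mul_comm]

lemma natBeta_zero_right (a : ℕ) : natBeta a 0 = 1 / ((a : ℝ) + 1) := by
  have := Nat.factorial_ne_zero a
  simp only [natBeta, Nat.factorial_zero, add_zero, Nat.factorial_succ, Nat.cast_mul]
  push_cast
  field_simp

lemma natBeta_succ_left (a b : ℕ) :
    natBeta (a + 1) b = natBeta a b * ((a + 1) / (a + b + 2)) := by
  have h : a + 1 + b + 1 = a + b + 1 + 1 := by omega
  rw [natBeta, natBeta, h, Nat.factorial_succ (a + b + 1), Nat.factorial_succ a]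
  push_cast
  field_simp
  ring

lemma natBeta_succ_right (a b : ℕ) :
    natBeta a (b + 1) = natBeta a b * ((b + 1) / (a + b + 2)) := by
  rw [natBeta_comm, natBeta_succ_left, natBeta_comm b a, add_comm (b : ℝ) a]

lemma choose_mul_natBeta {n x : ℕ} (hx : x ≤ n) :
    ((n : ℝ) + 1) * n.choose x * natBeta x (n - x) = 1 := by
  have h : ((n.choose x : ℝ) * x.factorial * (n - x).factorial) = n.factorial :=
    mod_cast Nat.choose_mul_factorial_mul_factorial hx
  rw [natBeta, Nat.add_sub_cancel' hx, Nat.factorial_succ, ← mul_div_assoc, div_eq_one_iff_eq]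
  · push_cast; rw [← h]; ring
  · positivity

lemma harmonicSum_succ (k : ℕ) : harmonicSum (k + 1) = harmonicSum k + 1 / ((k : ℝ) + 1) := by
  simp [harmonicSum, Finset.sum_range_succ]

lemma harmonicSum_eq_harmonic (k : ℕ) : harmonicSum k = (harmonic k : ℝ) := by
  simp [harmonicSum, harmonic]

lemma integral_pow_mul_one_sub_pow (a b : ℕ) :
    ∫ p in (0 : ℝ)..1, p ^ a * (1 - p) ^ b = natBeta a b := by
  induction b generalizing a with
  | zero => simp [natBeta_zero_right]
  | succ b ih =>
    have h : ∀ p : ℝ, p ^ a * (1 - p) ^ (b + 1) = p ^ a * (1 - p) ^ b - p ^ (a + 1) * (1 - p) ^ b :=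
      fun p => by ring
    simp_rw [h]
    rw [intervalIntegral.integral_sub (Continuous.intervalIntegrable (by fun_prop) _ _)
      (Continuous.intervalIntegrable (by fun_prop) _ _), ih, ih, natBeta_succ_left,
      natBeta_succ_right]
    field_simp
    ring

lemma intervalIntegrable_pow_mul_one_sub_pow_mul_log (a b : ℕ) (u v : ℝ) :
    IntervalIntegrable (fun p : ℝ => p ^ a * (1 - p) ^ b * log p) volume u v :=
  intervalIntegral.intervalIntegrable_log'.continuousOn_mul (by fun_prop)

lemma integral_pow_mul_log (a : ℕ) :
    ∫ p in (0 : ℝ)..1, p ^ a * log p = -(1 / ((a : ℝ) + 1) ^ 2) := by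
  have hcont : Continuous fun p : ℝ =>
      p ^ a * (p * log p) / ((a : ℝ) + 1) - p ^ (a + 1) / ((a : ℝ) + 1) ^ 2 := by
    have := Real.continuous_mul_log
    fun_prop
  rw [intervalIntegral.integral_eq_sub_of_hasDerivAt_of_le zero_le_one hcont.continuousOn (f' :=
    fun p => p ^ a * log p)]
  · simp
  · intro p hp
    have hp0 : p ≠ 0 := hp.1.ne'
    have h := (((hasDerivAt_pow (a + 1) p).mul (Real.hasDerivAt_log hp0)).div_const
      ((a : ℝ) + 1)).sub ((hasDerivAt_pow (a + 1) p).div_const (((a : ℝ) + 1) ^ 2))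
    refine (h.congr_of_eventuallyEq (.of_forall fun q => ?_)).congr_deriv ?_
    · simp only [Pi.mul_apply, Pi.sub_apply]; ring
    · push_cast
      field_simp
      ring
  · simpa using intervalIntegrable_pow_mul_one_sub_pow_mul_log a 0 0 1

lemma integral_pow_mul_one_sub_pow_mul_log (a b : ℕ) :
    ∫ p in (0 : ℝ)..1, p ^ a * (1 - p) ^ b * log p =
      natBeta a b * (harmonicSum a - harmonicSum (a + b + 1)) := by
  induction b generalizing a with
  | zero =>
    simp only [pow_zero, mul_one, integral_pow_mul_log, natBeta_zero_right, add_zero,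
      harmonicSum_succ]
    field_simp
    ring
  | succ b ih =>
    have h : ∀ p : ℝ, p ^ a * (1 - p) ^ (b + 1) * log p =
        p ^ a * (1 - p) ^ b * log p - p ^ (a + 1) * (1 - p) ^ b * log p := fun p => by ring
    simp_rw [h]
    rw [intervalIntegral.integral_sub (intervalIntegrable_pow_mul_one_sub_pow_mul_log ..)
      (intervalIntegrable_pow_mul_one_sub_pow_mul_log ..), ih, ih, natBeta_succ_left,
      natBeta_succ_right, show a + 1 + b + 1 = a + b + 1 + 1 by omega,
      show a + (b + 1) + 1 = a + b + 1 + 1 by omega, harmonicSum_succ (a + b + 1),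
      harmonicSum_succ a]
    push_cast
    have h2 : (a : ℝ) + b + 1 + 1 = a + b + 2 := by ring
    rw [h2]
    field_simp
    ring

lemma intervalIntegrable_pow_mul_one_sub_pow_mul_log_one_sub (a b : ℕ) :
    IntervalIntegrable (fun p : ℝ => p ^ a * (1 - p) ^ b * log (1 - p)) volume 0 1 := by
  have h := (intervalIntegrable_pow_mul_one_sub_pow_mul_log b a 1 0).comp_sub_left 1
  simp only [sub_self, sub_zero, sub_sub_cancel] at h
  exact h.congr (fun p _ => by ring)

lemma integral_pow_mul_one_sub_pow_mul_log_one_sub (a b : ℕ) :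
    ∫ p in (0 : ℝ)..1, p ^ a * (1 - p) ^ b * log (1 - p) =
      natBeta a b * (harmonicSum b - harmonicSum (a + b + 1)) := by
  have h := intervalIntegral.integral_comp_sub_left (a := 0) (b := 1)
    (fun p : ℝ => p ^ b * (1 - p) ^ a * log p) 1
  simp only [sub_self, sub_zero, sub_sub_cancel, integral_pow_mul_one_sub_pow_mul_log] at h
  rw [natBeta_comm, add_comm a b, ← h]
  simp_rw [mul_comm]

/-- The differential entropy of a Beta density with integer parameters, in closed form. -/
lemma diffEntropy_betaDensity {n x : ℕ} (hx : x < n) :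
    diffEntropy (betaDensity n x) = -log (((n : ℝ) + 1) * n.choose x) +
      x * (harmonicSum (n + 1) - harmonicSum x) +
      (n - x : ℕ) * (harmonicSum (n + 1) - harmonicSum (n - x)) := by
  obtain ⟨c, rfl⟩ := Nat.exists_eq_add_of_lt hx
  have hB := choose_mul_natBeta hx.le
  have hC : (0 : ℝ) < ((x + c + 1 : ℕ) + 1) * (x + c + 1).choose x :=
    mul_pos (by positivity) (mod_cast Nat.choose_pos hx.le)
  have hsub : x + c + 1 - x = c + 1 := by omega
  rw [diffEntropy]
  simp only [betaDensity, hsub] at hB ⊢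
  set C : ℝ := ((x + c + 1 : ℕ) + 1) * (x + c + 1).choose x
  have hset : ∫ z : ℝ, (if 0 ≤ z ∧ z ≤ 1 then C * z ^ x * (1 - z) ^ (c + 1) else 0) *
      log (if 0 ≤ z ∧ z ≤ 1 then C * z ^ x * (1 - z) ^ (c + 1) else 0) =
      ∫ z in (0 : ℝ)..1, (C * log C * (z ^ x * (1 - z) ^ (c + 1)) +
        C * x * (z ^ x * (1 - z) ^ (c + 1) * log z) +
        C * (c + 1 : ℕ) * (z ^ x * (1 - z) ^ (c + 1) * log (1 - z))) := by
    rw [intervalIntegral.integral_of_le zero_le_one, ← integral_Icc_eq_integral_Ioc,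
      ← setIntegral_eq_integral_of_forall_compl_eq_zero (s := Set.Icc (0 : ℝ) 1),
      integral_Icc_eq_integral_Ioc, integral_Icc_eq_integral_Ioc]
    · refine setIntegral_congr_fun measurableSet_Ioc fun z hz => ?_
      simp only [hz.1.le, hz.2, and_self, if_true]
      rcases hz.2.eq_or_lt with rfl | hz1
      · simp
      · have h1 : 0 < 1 - z := sub_pos.2 hz1
        have h0 : 0 < z := hz.1
        rw [log_mul (by positivity) (by positivity), log_mul (by positivity) (by positivity),
          log_pow, log_pow]
        ring
    · intro z hz
      rw [Set.mem_Icc] at hz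
      simp [hz]
  have hpow := (Continuous.intervalIntegrable (μ := volume) (a := 0) (b := 1)
    (u := fun z : ℝ => z ^ x * (1 - z) ^ (c + 1)) (by fun_prop)).const_mul (C * log C)
  have hlog := (intervalIntegrable_pow_mul_one_sub_pow_mul_log x (c + 1) 0 1).const_mul (C * x)
  rw [hset, intervalIntegral.integral_add (hpow.add hlog)
    ((intervalIntegrable_pow_mul_one_sub_pow_mul_log_one_sub x (c + 1)).const_mul _),
    intervalIntegral.integral_add hpow hlog, intervalIntegral.integral_const_mul,
    intervalIntegral.integral_const_mul, intervalIntegral.integral_const_mul,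
    integral_pow_mul_one_sub_pow, integral_pow_mul_one_sub_pow_mul_log,
    integral_pow_mul_one_sub_pow_mul_log_one_sub, ← add_assoc x c 1]
  linear_combination (-log C - x * (harmonicSum x - harmonicSum (x + c + 1 + 1)) -
    (c + 1 : ℕ) * (harmonicSum (c + 1) - harmonicSum (x + c + 1 + 1))) * hB

lemma tendsto_log_succ_sub_log :
    Tendsto (fun n : ℕ => log ((n : ℝ) + 1) - log n) atTop (𝓝 0) := by
  have h := tendsto_harmonic_sub_log.sub tendsto_harmonic_sub_log_add_one
  rw [sub_self] at h
  exact h.congr fun n => by ring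

lemma tendsto_harmonicSum_succ_sub_log :
    Tendsto (fun n : ℕ => harmonicSum (n + 1) - log n) atTop (𝓝 eulerMascheroniConstant) := by
  have h := ((tendsto_add_atTop_iff_nat 1).2 tendsto_harmonic_sub_log).add tendsto_log_succ_sub_log
  rw [add_zero] at h
  refine h.congr fun n => ?_
  rw [harmonicSum_eq_harmonic]
  push_cast
  ring

lemma tendsto_mul_harmonicSum_add_sub (k : ℕ) :
    Tendsto (fun m : ℕ => (m : ℝ) * (harmonicSum (m + k) - harmonicSum m)) atTop (𝓝 k) := by
  induction k with
  | zero => simp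
  | succ k ih =>
    have h : Tendsto (fun m : ℕ => (m : ℝ) / (m + ((k : ℝ) + 1))) atTop (𝓝 1) :=
      tendsto_natCast_div_add_atTop _
    rw [Nat.cast_succ]
    refine (ih.add h).congr fun m => ?_
    rw [← add_assoc m k 1, harmonicSum_succ]
    push_cast
    ring

lemma tendsto_log_choose_sub (c : ℕ) :
    Tendsto (fun n : ℕ => log (n.choose c) - c * log n) atTop (𝓝 (-log c.factorial)) := by
  have hne : ∀ᶠ n : ℕ in atTop, (n : ℝ) ^ c / c.factorial ≠ 0 := by
    filter_upwards [eventually_ne_atTop 0] with n hn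
    positivity
  have h := (Asymptotics.isEquivalent_iff_tendsto_one hne).1 (isEquivalent_choose c)
  have hlog := (h.log one_ne_zero).sub_const (log c.factorial)
  rw [log_one, zero_sub] at hlog
  refine hlog.congr' ?_
  filter_upwards [eventually_ge_atTop c, eventually_ne_atTop 0] with n hn hn0
  have hchoose : (n.choose c : ℝ) ≠ 0 := mod_cast (Nat.choose_pos hn).ne'
  rw [Pi.div_apply, log_div hchoose (by positivity), log_div (by positivity) (by positivity),
    log_pow]
  ring

/-- For a fixed positive integer `c₂` and `x = n - c₂` (a constant number of
failures), `h(f_{n,n-c₂}) + log n → c₂ + log(c₂!) - c₂(H_{c₂} - γ) + 1`, where `γ` is the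
Euler–Mascheroni constant. -/
theorem entropy_asymptotics_constant_failures (c₂ : ℕ) (hc₂ : 0 < c₂) :
    Tendsto (fun n : ℕ => diffEntropy (betaDensity n (n - c₂)) + Real.log n) atTop
      (nhds ((c₂ : ℝ) + Real.log (Nat.factorial c₂) -
        c₂ * (harmonicSum c₂ - Real.eulerMascheroniConstant) + 1)) := by
  have hx : Tendsto (fun n : ℕ => ((n - c₂ : ℕ) : ℝ) *
      (harmonicSum (n - c₂ + (c₂ + 1)) - harmonicSum (n - c₂))) atTop (𝓝 ((c₂ + 1 : ℕ) : ℝ)) :=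
    (tendsto_mul_harmonicSum_add_sub (c₂ + 1)).comp (tendsto_sub_atTop_nat c₂)
  have h := ((hx.sub (tendsto_log_choose_sub c₂)).sub tendsto_log_succ_sub_log).add
    ((tendsto_harmonicSum_succ_sub_log.sub_const (harmonicSum c₂)).const_mul (c₂ : ℝ))
  have hlim : ((c₂ + 1 : ℕ) : ℝ) - -log c₂.factorial - 0 +
      c₂ * (eulerMascheroniConstant - harmonicSum c₂) = (c₂ : ℝ) + Real.log (Nat.factorial c₂) -
        c₂ * (harmonicSum c₂ - Real.eulerMascheroniConstant) + 1 := by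
    push_cast
    ring
  rw [hlim] at h
  refine h.congr' ?_
  filter_upwards [eventually_ge_atTop c₂] with n hn
  have hchoose : (n.choose c₂ : ℝ) ≠ 0 := mod_cast (Nat.choose_pos hn).ne'
  rw [diffEntropy_betaDensity (by omega), Nat.choose_symm hn, Nat.sub_sub_self hn,
    show n - c₂ + (c₂ + 1) = n + 1 by omega, log_mul (by positivity) hchoose]
  ring
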